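/- Let A ⊆ C, B ⊆ D, K ⊆ L be unital inclusions of unital C*-algebras with conditional expectations E^A, E^B, E^K of Watatani index-finite type, with A' ∩ C = C·1. Suppose A ⊆ C is strongly Morita equivalent to B ⊆ D via (X,Y) and B ⊆ D is strongly Morita equivalent to K ⊆ L via (Z,W). Let C_1, D_1, L_1 be the C*-basic constructions for E^A, E^B, E^K, let Y_1 and W_1 be the upward basic constructions of Y and W for the unique conditional expectations E^X: Y → X and E^Z: W → Z, and let (Y⊗_D W)_1 be the upward basic construction of Y⊗_D W for the unique conditional expectation E^{X⊗_B Z}. Then (Y⊗_D W)_1 ≅ Y_1 ⊗_{D_1} W_1 as C_1–L_1-equivalence bimodules, via the map Φ(c⊗x⊗d̃⊗d'⊗z⊗l̃) = c⊗x⊗E^B(d*d')·z⊗l̃. -/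

import Mathlib

open scoped MultiplierAlgebra

noncomputable section

structure EquivBimodule (C D Y : Type*)
    [NonUnitalCStarAlgebra C] [PartialOrder C] [StarOrderedRing C]
    [NonUnitalCStarAlgebra D] [PartialOrder D] [StarOrderedRing D]
    [NormedAddCommGroup Y] [NormedSpace ℂ Y] [CompleteSpace Y] : Type _ where
  lsmul : C → Y → Y
  rsmul : Y → D → Y
  linn : Y → Y → C
  rinn : Y → Y → D
  lsmul_add : ∀ c x y, lsmul c (x + y) = lsmul c x + lsmul c y
  add_lsmul : ∀ c c' x, lsmul (c + c') x = lsmul c x + lsmul c' x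
  mul_lsmul : ∀ c c' x, lsmul (c * c') x = lsmul c (lsmul c' x)
  smul_lsmul : ∀ (z : ℂ) c x, lsmul (z • c) x = z • lsmul c x
  lsmul_smul : ∀ (z : ℂ) c x, lsmul c (z • x) = z • lsmul c x
  add_rsmul : ∀ x y d, rsmul (x + y) d = rsmul x d + rsmul y d
  rsmul_add : ∀ x d d', rsmul x (d + d') = rsmul x d + rsmul x d'
  rsmul_mul : ∀ x d d', rsmul x (d * d') = rsmul (rsmul x d) d'
  rsmul_smul : ∀ (z : ℂ) x d, rsmul (z • x) d = z • rsmul x d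
  smul_rsmul : ∀ (z : ℂ) x d, rsmul x (z • d) = z • rsmul x d
  lsmul_rsmul : ∀ c x d, rsmul (lsmul c x) d = lsmul c (rsmul x d)
  linn_add_left : ∀ x y z, linn (x + y) z = linn x z + linn y z
  linn_smul_left : ∀ (t : ℂ) x y, linn (t • x) y = t • linn x y
  linn_star : ∀ x y, star (linn x y) = linn y x
  linn_lsmul_left : ∀ c x y, linn (lsmul c x) y = c * linn x y
  linn_nonneg : ∀ x, 0 ≤ linn x x
  linn_definite : ∀ x, linn x x = 0 → x = 0
  rinn_add_right : ∀ x y z, rinn x (y + z) = rinn x y + rinn x z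
  rinn_smul_right : ∀ (t : ℂ) x y, rinn x (t • y) = t • rinn x y
  rinn_star : ∀ x y, star (rinn x y) = rinn y x
  rinn_rsmul_right : ∀ x y d, rinn x (rsmul y d) = rinn x y * d
  rinn_nonneg : ∀ x, 0 ≤ rinn x x
  rinn_definite : ∀ x, rinn x x = 0 → x = 0
  imprimitivity : ∀ x y z, lsmul (linn x y) z = rsmul x (rinn y z)
  norm_linn : ∀ x, ‖linn x x‖ = ‖x‖ ^ 2
  norm_rinn : ∀ x, ‖rinn x x‖ = ‖x‖ ^ 2
  full_left : Dense (Submodule.span ℂ {c : C | ∃ x y, c = linn x y} : Set C)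
  full_right : Dense (Submodule.span ℂ {d : D | ∃ x y, d = rinn x y} : Set D)

namespace EquivBimodule

variable {C D Y W : Type*}
    [NonUnitalCStarAlgebra C] [PartialOrder C] [StarOrderedRing C]
    [NonUnitalCStarAlgebra D] [PartialOrder D] [StarOrderedRing D]
    [NormedAddCommGroup Y] [NormedSpace ℂ Y] [CompleteSpace Y]
    [NormedAddCommGroup W] [NormedSpace ℂ W] [CompleteSpace W]

structure Iso (E : EquivBimodule C D Y) (F : EquivBimodule C D W) where
  toEquiv : Y ≃ₗ[ℂ] W
  map_lsmul : ∀ c y, toEquiv (E.lsmul c y) = F.lsmul c (toEquiv y)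
  map_rsmul : ∀ y d, toEquiv (E.rsmul y d) = F.rsmul (toEquiv y) d
  map_linn : ∀ x y, F.linn (toEquiv x) (toEquiv y) = E.linn x y
  map_rinn : ∀ x y, F.rinn (toEquiv x) (toEquiv y) = E.rinn x y

end EquivBimodule

def DenseIncl {A C : Type*} [NonUnitalCStarAlgebra C] (ι : A → C) : Prop :=
  Dense (Submodule.span ℂ {x : C | ∃ (a : A) (c : C), x = ι a * c} : Set C)

structure IsMoritaIncl {A B C D Y : Type*}
    [NonUnitalCStarAlgebra C] [PartialOrder C] [StarOrderedRing C]
    [NonUnitalCStarAlgebra D] [PartialOrder D] [StarOrderedRing D]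
    [NormedAddCommGroup Y] [NormedSpace ℂ Y] [CompleteSpace Y]
    (ιA : A → C) (ιB : B → D)
    (E : EquivBimodule C D Y) (X : Submodule ℂ Y) : Prop where
  closed : IsClosed (X : Set Y)
  lsmul_mem : ∀ (a : A), ∀ x ∈ X, E.lsmul (ιA a) x ∈ X
  rsmul_mem : ∀ (b : B), ∀ x ∈ X, E.rsmul x (ιB b) ∈ X
  linn_mem : ∀ x ∈ X, ∀ y ∈ X, E.linn x y ∈ Set.range ιA
  rinn_mem : ∀ x ∈ X, ∀ y ∈ X, E.rinn x y ∈ Set.range ιB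
  span_XX_left :
    closure (Submodule.span ℂ {c : C | ∃ x ∈ X, ∃ y ∈ X, c = E.linn x y} : Set C) = Set.range ιA
  span_YX_left :
    Dense (Submodule.span ℂ {c : C | ∃ (y : Y), ∃ x ∈ X, c = E.linn y x} : Set C)
  span_XX_right :
    closure (Submodule.span ℂ {d : D | ∃ x ∈ X, ∃ y ∈ X, d = E.rinn x y} : Set D) = Set.range ιB
  span_YX_right :
    Dense (Submodule.span ℂ {d : D | ∃ (y : Y), ∃ x ∈ X, d = E.rinn y x} : Set D)

abbrev IsEquiPair {A C Y : Type*}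
    [NonUnitalCStarAlgebra C] [PartialOrder C] [StarOrderedRing C]
    [NormedAddCommGroup Y] [NormedSpace ℂ Y] [CompleteSpace Y]
    (ι : A → C) (E : EquivBimodule C C Y) (X : Submodule ℂ Y) : Prop :=
  IsMoritaIncl ι ι E X

def PairEquiv {C D Y W : Type*}
    [NonUnitalCStarAlgebra C] [PartialOrder C] [StarOrderedRing C]
    [NonUnitalCStarAlgebra D] [PartialOrder D] [StarOrderedRing D]
    [NormedAddCommGroup Y] [NormedSpace ℂ Y] [CompleteSpace Y]
    [NormedAddCommGroup W] [NormedSpace ℂ W] [CompleteSpace W]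
    (E : EquivBimodule C D Y) (X : Submodule ℂ Y)
    (F : EquivBimodule C D W) (Z : Submodule ℂ W) : Prop :=
  ∃ Φ : E.Iso F, X.map Φ.toEquiv.toLinearMap = Z

def IsTrivialData {C : Type*}
    [NonUnitalCStarAlgebra C] [PartialOrder C] [StarOrderedRing C]
    (T : EquivBimodule C C C) : Prop :=
  T.lsmul = (fun c x => c * x) ∧ T.rsmul = (fun x c => x * c) ∧
    T.linn = (fun x y => x * star y) ∧ T.rinn = (fun x y => star x * y)

/-- The data of the equivalence bimodule `Y_σ` induced by an automorphism with
underlying map `σ` (with inverse `σinv`). -/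
def IsAlphaData {C : Type*}
    [NonUnitalCStarAlgebra C] [PartialOrder C] [StarOrderedRing C]
    (σ σinv : C → C) (T : EquivBimodule C C C) : Prop :=
  T.lsmul = (fun c x => c * x) ∧ T.rsmul = (fun x c => x * σ c) ∧
    T.linn = (fun x y => x * star y) ∧ T.rinn = (fun x y => σinv (star x * y))

/-- The submodule `{ι a | a : A}` of `C`, e.g. the subspace `X_α = A` of `Y_α = C`. -/
def rangeSub {A C : Type*} [NonUnitalCStarAlgebra C]
    (ι : A → C) : Submodule ℂ C :=
  Submodule.span ℂ (Set.range ι)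

/-- A realization of the interior tensor product `Y ⊗_D W` of equivalence bimodules. -/
structure IsTensorProd {C D L Y W V : Type*}
    [NonUnitalCStarAlgebra C] [PartialOrder C] [StarOrderedRing C]
    [NonUnitalCStarAlgebra D] [PartialOrder D] [StarOrderedRing D]
    [NonUnitalCStarAlgebra L] [PartialOrder L] [StarOrderedRing L]
    [NormedAddCommGroup Y] [NormedSpace ℂ Y] [CompleteSpace Y]
    [NormedAddCommGroup W] [NormedSpace ℂ W] [CompleteSpace W]
    [NormedAddCommGroup V] [NormedSpace ℂ V] [CompleteSpace V]
    (E : EquivBimodule C D Y) (G : EquivBimodule D L W)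
    (F : EquivBimodule C L V) (s : Y → W → V) : Prop where
  add_left : ∀ y y' w, s (y + y') w = s y w + s y' w
  smul_left : ∀ (z : ℂ) y w, s (z • y) w = z • s y w
  add_right : ∀ y w w', s y (w + w') = s y w + s y w'
  smul_right : ∀ (z : ℂ) y w, s y (z • w) = z • s y w
  balanced : ∀ y d w, s (E.rsmul y d) w = s y (G.lsmul d w)
  map_lsmul : ∀ c y w, F.lsmul c (s y w) = s (E.lsmul c y) w
  map_rsmul : ∀ y w l, F.rsmul (s y w) l = s y (G.rsmul w l)
  map_linn : ∀ y y' w w',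
    F.linn (s y w) (s y' w') = E.linn (E.rsmul y (G.linn w w')) y'
  map_rinn : ∀ y y' w w',
    F.rinn (s y w) (s y' w') = G.rinn w (G.lsmul (E.rinn y y') w')
  dense : Dense (Submodule.span ℂ {v : V | ∃ y w, v = s y w} : Set V)

/-- A realization of the product of two elements of `Equi(A, C)`:
the tensor product bimodule together with the distinguished subspace `X₁ ⊗ X₂`. -/
structure IsPairTensor {A C Y W V : Type*}
    [NonUnitalCStarAlgebra C] [PartialOrder C] [StarOrderedRing C]
    [NormedAddCommGroup Y] [NormedSpace ℂ Y] [CompleteSpace Y]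
    [NormedAddCommGroup W] [NormedSpace ℂ W] [CompleteSpace W]
    [NormedAddCommGroup V] [NormedSpace ℂ V] [CompleteSpace V]
    (ι : A → C)
    (E₁ : EquivBimodule C C Y) (X₁ : Submodule ℂ Y)
    (E₂ : EquivBimodule C C W) (X₂ : Submodule ℂ W)
    (G : EquivBimodule C C V) (XV : Submodule ℂ V) (s : Y → W → V) : Prop where
  tensor : IsTensorProd E₁ E₂ G s
  sub : (XV : Set V) =
    closure (Submodule.span ℂ {v : V | ∃ x ∈ X₁, ∃ z ∈ X₂, v = s x z} : Set V)

section Multiplier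

variable {C : Type*} [NonUnitalCStarAlgebra C]

/-- Conjugation `c ↦ u c u*` by a (unitary) multiplier `u ∈ M(C)`. -/
def mAd (u : 𝓜(ℂ, C)) (c : C) : C := u.fst ((star u).snd c)

/-- `m ∈ M(C)` is (the extension of) a multiplier of the subalgebra `A` (realized by
`ι : A → C`): it maps `A` into `A` on both sides.  When `AC` is dense in `C`, the
multiplier algebra `M(A)` is exactly the set of such multipliers. -/
def IsMultiplierOf {A : Type*} (ι : A → C) (m : 𝓜(ℂ, C)) : Prop :=
  (∀ a : A, m.fst (ι a) ∈ Set.range ι) ∧ (∀ a : A, m.snd (ι a) ∈ Set.range ι)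

/-- `u ∈ K(M(C))`: a unitary multiplier with `u a u*, u* a u ∈ A` for all `a ∈ A`. -/
def mem_KMC {A : Type*} (ι : A → C) (u : 𝓜(ℂ, C)) : Prop :=
  u ∈ unitary 𝓜(ℂ, C) ∧ (∀ a : A, mAd u (ι a) ∈ Set.range ι) ∧
    (∀ a : A, mAd (star u) (ι a) ∈ Set.range ι)

/-- The subspace `Au = {a u | a ∈ A}` of `C`, for a multiplier `u ∈ M(C)`. -/
def AuSub {A : Type*} (ι : A → C) (u : 𝓜(ℂ, C)) : Submodule ℂ C :=
  Submodule.span ℂ {x : C | ∃ a : A, x = u.snd (ι a)}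

end Multiplier

/-- A positive element `h` with `hA` dense in `A`; a C*-algebra is σ-unital iff it
possesses such a (strictly positive) element. -/
def SigmaUnital (A : Type*) [NonUnitalCStarAlgebra A] [PartialOrder A]
    [StarOrderedRing A] : Prop :=
  ∃ h : A, 0 ≤ h ∧ Dense (Set.range fun a : A => h * a)

/-- A system of matrix units over `C` realizing `Cs` as the stabilization `C ⊗ K`. -/
structure IsStabilization {C Cs : Type*} [NonUnitalCStarAlgebra C]
    [NonUnitalCStarAlgebra Cs] (e : ℕ → ℕ → C → Cs) : Prop where
  map_add : ∀ i j c c', e i j (c + c') = e i j c + e i j c'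
  map_smul : ∀ i j (z : ℂ) c, e i j (z • c) = z • e i j c
  map_mul : ∀ i j k l c d, e i j c * e k l d = if j = k then e i l (c * d) else 0
  map_star : ∀ i j c, star (e i j c) = e j i (star c)
  isometry : ∀ i j c, ‖e i j c‖ = ‖c‖
  dense : Dense (Submodule.span ℂ {x : Cs | ∃ i j c, x = e i j c} : Set Cs)

section Unital

variable {A B C D : Type*} [CStarAlgebra A] [CStarAlgebra B] [CStarAlgebra C] [CStarAlgebra D]
  [PartialOrder C] [StarOrderedRing C] [PartialOrder D] [StarOrderedRing D]

/-- A conditional expectation from `C` onto `A`, for a unital inclusion realized by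
`ι : A →⋆ₐ[ℂ] C`. -/
structure CondExpectation [PartialOrder A] [StarOrderedRing A] (ι : A →⋆ₐ[ℂ] C) where
  toFun : C → A
  map_add : ∀ x y, toFun (x + y) = toFun x + toFun y
  map_smul : ∀ (z : ℂ) x, toFun (z • x) = z • toFun x
  map_star : ∀ x, toFun (star x) = star (toFun x)
  retraction : ∀ a, toFun (ι a) = a
  left_mod : ∀ a c, toFun (ι a * c) = a * toFun c
  right_mod : ∀ c a, toFun (c * ι a) = toFun c * a
  pos : ∀ c, 0 ≤ toFun (star c * c)

/-- A quasi-basis for a conditional expectation, in the sense of Watatani. -/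
def IsQuasiBasis [PartialOrder A] [StarOrderedRing A] {ι : A →⋆ₐ[ℂ] C}
    (E : CondExpectation ι) {n : ℕ} (u : Fin n → C) : Prop :=
  ∀ c : C, (∑ i, u i * ι (E.toFun (star (u i) * c)) = c) ∧
    (∑ i, ι (E.toFun (c * u i)) * star (u i) = c)

/-- A conditional expectation is of Watatani index-finite type if it admits a
quasi-basis. -/
def FiniteIndex [PartialOrder A] [StarOrderedRing A] {ι : A →⋆ₐ[ℂ] C}
    (E : CondExpectation ι) : Prop :=
  ∃ (n : ℕ) (u : Fin n → C), IsQuasiBasis E u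

/-- `A' ∩ C = ℂ 1` for the inclusion realized by `ι`. -/
def IrreducibleIncl (ι : A →⋆ₐ[ℂ] C) : Prop :=
  ∀ c : C, (∀ a : A, ι a * c = c * ι a) → ∃ z : ℂ, c = z • (1 : C)

variable [PartialOrder A] [StarOrderedRing A] [PartialOrder B] [StarOrderedRing B]

/-- A conditional expectation `E^X : Y → X` with respect to `E^A` and `E^B`
(Definition 2.4 of [KT4]). -/
structure IsBimodCondExp {Y : Type*}
    [NormedAddCommGroup Y] [NormedSpace ℂ Y] [CompleteSpace Y]
    (ιA : A →⋆ₐ[ℂ] C) (ιB : B →⋆ₐ[ℂ] D)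
    (EA : CondExpectation ιA) (EB : CondExpectation ιB)
    (EY : EquivBimodule C D Y) (X : Submodule ℂ Y) (EX : Y → Y) : Prop where
  map_add : ∀ y y', EX (y + y') = EX y + EX y'
  map_smul : ∀ (z : ℂ) y, EX (z • y) = z • EX y
  mem : ∀ y, EX y ∈ X
  cond1 : ∀ (c : C), ∀ x ∈ X, EX (EY.lsmul c x) = EY.lsmul (ιA (EA.toFun c)) x
  cond2 : ∀ (a : A) (y : Y), EX (EY.lsmul (ιA a) y) = EY.lsmul (ιA a) (EX y)
  cond3 : ∀ (y : Y), ∀ x ∈ X, ιA (EA.toFun (EY.linn y x)) = EY.linn (EX y) x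
  cond4 : ∀ (d : D), ∀ x ∈ X, EX (EY.rsmul x d) = EY.rsmul x (ιB (EB.toFun d))
  cond5 : ∀ (b : B) (y : Y), EX (EY.rsmul y (ιB b)) = EY.rsmul (EX y) (ιB b)
  cond6 : ∀ (y : Y), ∀ x ∈ X, ιB (EB.toFun (EY.rinn y x)) = EY.rinn (EX y) x

/-- The C*-basic construction `C₁` for a conditional expectation `E : C → A`,
realized by a unital embedding `ιC : C →⋆ₐ[ℂ] C₁` and the Jones projection `e`. -/
structure IsBasicConstruction {A C C₁ : Type*} [CStarAlgebra A] [CStarAlgebra C]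
    [CStarAlgebra C₁] [PartialOrder A] [StarOrderedRing A]
    [PartialOrder C] [StarOrderedRing C]
    (ι : A →⋆ₐ[ℂ] C) (E : CondExpectation ι)
    (ιC : C →⋆ₐ[ℂ] C₁) (e : C₁) : Prop where
  inj : Function.Injective ιC
  idem : e * e = e
  selfadj : star e = e
  comm : ∀ a : A, ιC (ι a) * e = e * ιC (ι a)
  expect : ∀ c : C, e * ιC c * e = ιC (ι (E.toFun c)) * e
  faithful : ∀ c : C, ιC c * e = 0 → c = 0
  span : ∀ x : C₁, x ∈ Submodule.span ℂ {z : C₁ | ∃ c d : C, z = ιC c * e * ιC d}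

end Unital

/-- `M` is the `A–B`-equivalence bimodule obtained by restricting the operations of the
`C–D`-equivalence bimodule `EY` to the closed subspace `X` (whose inner products on `X`
take values in the subalgebras realized by `ιA`, `ιB`). -/
structure IsRestriction {A B C D Y : Type*}
    [NonUnitalCStarAlgebra A] [PartialOrder A] [StarOrderedRing A]
    [NonUnitalCStarAlgebra B] [PartialOrder B] [StarOrderedRing B]
    [NonUnitalCStarAlgebra C] [PartialOrder C] [StarOrderedRing C]
    [NonUnitalCStarAlgebra D] [PartialOrder D] [StarOrderedRing D]
    [NormedAddCommGroup Y] [NormedSpace ℂ Y] [CompleteSpace Y]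
    (ιA : A → C) (ιB : B → D)
    (EY : EquivBimodule C D Y) (X : Submodule ℂ Y) [CompleteSpace X]
    (M : EquivBimodule A B X) : Prop where
  lsmul_coe : ∀ (a : A) (x : X), (M.lsmul a x : Y) = EY.lsmul (ιA a) (x : Y)
  rsmul_coe : ∀ (x : X) (b : B), (M.rsmul x b : Y) = EY.rsmul (x : Y) (ιB b)
  linn_coe : ∀ x y : X, ιA (M.linn x y) = EY.linn (x : Y) (y : Y)
  rinn_coe : ∀ x y : X, ιB (M.rinn x y) = EY.rinn (x : Y) (y : Y)

section Upward

variable {A B C D C₁ D₁ : Type*} [CStarAlgebra A] [CStarAlgebra B] [CStarAlgebra C]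
  [CStarAlgebra D] [CStarAlgebra C₁] [CStarAlgebra D₁]
  [PartialOrder A] [StarOrderedRing A] [PartialOrder B] [StarOrderedRing B]
  [PartialOrder C] [StarOrderedRing C] [PartialOrder D] [StarOrderedRing D]
  [PartialOrder C₁] [StarOrderedRing C₁] [PartialOrder D₁] [StarOrderedRing D₁]

/-- A realization of the upward basic construction `C ⊗_A X ⊗_B D̃` as a
`C₁–D₁`-equivalence bimodule, where `M` is the middle `A–B`-equivalence bimodule
(`X` regarded as an `A–B`-bimodule), together with the canonical trilinear map `t`
(the map `(c, x, d) ↦ c ⊗ x ⊗ d̃`, conjugate-linear in the last variable). -/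
structure IsUpwardBasic {Xc T : Type*}
    [NormedAddCommGroup Xc] [NormedSpace ℂ Xc] [CompleteSpace Xc]
    [NormedAddCommGroup T] [NormedSpace ℂ T] [CompleteSpace T]
    (ιA : A →⋆ₐ[ℂ] C) (ιB : B →⋆ₐ[ℂ] D)
    (EA : CondExpectation ιA) (EB : CondExpectation ιB)
    (M : EquivBimodule A B Xc)
    (ιC : C →⋆ₐ[ℂ] C₁) (eA : C₁) (ιD : D →⋆ₐ[ℂ] D₁) (eB : D₁)
    (F : EquivBimodule C₁ D₁ T) (t : C → Xc → D → T) : Prop where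
  add₁ : ∀ c c' x d, t (c + c') x d = t c x d + t c' x d
  smul₁ : ∀ (z : ℂ) c x d, t (z • c) x d = z • t c x d
  add₂ : ∀ c x x' d, t c (x + x') d = t c x d + t c x' d
  smul₂ : ∀ (z : ℂ) c x d, t c (z • x) d = z • t c x d
  add₃ : ∀ c x d d', t c x (d + d') = t c x d + t c x d'
  smul₃ : ∀ (z : ℂ) c x d, t c x (z • d) = (starRingEnd ℂ z) • t c x d
  balanced₁ : ∀ (a : A) c x d, t (c * ιA a) x d = t c (M.lsmul a x) d
  balanced₂ : ∀ (b : B) c x d, t c (M.rsmul x b) d = t c x (d * ιB (star b))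
  map_lsmul : ∀ c' c x d, F.lsmul (ιC c') (t c x d) = t (c' * c) x d
  map_eA : ∀ c x d, F.lsmul eA (t c x d) = t (ιA (EA.toFun c)) x d
  map_rsmul : ∀ c x d d', F.rsmul (t c x d) (ιD d') = t c x (star d' * d)
  map_eB : ∀ c x d, F.rsmul (t c x d) eB = t c x (ιB (EB.toFun d))
  linn_eq : ∀ c c' x x' d d',
    F.linn (t c x d) (t c' x' d') =
      ιC (c * ιA (M.linn (M.rsmul x (EB.toFun (star d * d'))) x')) * eA * ιC (star c')
  rinn_eq : ∀ c c' x x' d d',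
    F.rinn (t c x d) (t c' x' d') =
      ιD d * eB * ιD (ιB (M.rinn x (M.lsmul (EA.toFun (star c * c')) x')) * star d')
  dense : Dense (Submodule.span ℂ {v : T | ∃ c x d, v = t c x d} : Set T)

end Upward



/-! ### Helper material for the proof -/

/-- A `C`-valued hermitian form inducing the norm. -/
structure HermForm {C Y : Type*} [NonUnitalCStarAlgebra C]
    [NormedAddCommGroup Y] [NormedSpace ℂ Y] (P : Y → Y → C) : Prop where
  add_left : ∀ x y z, P (x + y) z = P x z + P y z
  smul_left : ∀ (t : ℂ) x y, P (t • x) y = t • P x y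
  star_eq : ∀ x y, star (P x y) = P y x
  norm_eq : ∀ x, ‖P x x‖ = ‖x‖ ^ 2

namespace HermForm

variable {C Y V : Type*} [NonUnitalCStarAlgebra C]
    [NormedAddCommGroup Y] [NormedSpace ℂ Y] [NormedAddCommGroup V] [NormedSpace ℂ V]
    {P : Y → Y → C} {Q : V → V → C}

theorem add_right (h : HermForm P) (x y z : Y) : P x (y + z) = P x y + P x z := by
  rw [← h.star_eq, h.add_left, star_add, h.star_eq, h.star_eq]

theorem smul_right (h : HermForm P) (t : ℂ) (x y : Y) :
    P x (t • y) = (starRingEnd ℂ t) • P x y := by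
  rw [← h.star_eq, h.smul_left, star_smul, h.star_eq]
  rfl

theorem bound_aux (h : HermForm P) (x y : Y) : ‖P x y‖ ≤ (‖x‖ + ‖y‖) ^ 2 := by
  have key : (4 : ℂ) • P x y = P (x + y) (x + y) - P (x + (-1 : ℂ) • y) (x + (-1 : ℂ) • y)
      + Complex.I • P (x + Complex.I • y) (x + Complex.I • y)
      - Complex.I • P (x + (-Complex.I) • y) (x + (-Complex.I) • y) := by
    simp only [h.add_left, h.add_right, h.smul_left, h.smul_right, smul_add, smul_smul,
      map_neg, map_one, Complex.conj_I]
    have hI : Complex.I * Complex.I = -1 := Complex.I_mul_I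
    match_scalars <;> ring_nf <;> simp <;> norm_num
  have hb : ∀ t : ℂ, ‖t‖ = 1 → ‖P (x + t • y) (x + t • y)‖ ≤ (‖x‖ + ‖y‖) ^ 2 := by
    intro t ht
    rw [h.norm_eq]
    have : ‖x + t • y‖ ≤ ‖x‖ + ‖y‖ := by
      refine (norm_add_le _ _).trans ?_
      rw [norm_smul, ht, one_mul]
    gcongr
  have h1 := hb 1 (by simp)
  rw [one_smul] at h1
  have h2 := hb (-1) (by simp)
  have h3 := hb Complex.I (by simp)
  have h4 := hb (-Complex.I) (by simp)
  have hn : ‖(4 : ℂ) • P x y‖ = 4 * ‖P x y‖ := by rw [norm_smul]; simp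
  have : ‖(4 : ℂ) • P x y‖ ≤ 4 * (‖x‖ + ‖y‖) ^ 2 := by
    rw [key]
    refine (norm_sub_le _ _).trans ?_
    have a1 := norm_add_le (P (x + y) (x + y) - P (x + (-1 : ℂ) • y) (x + (-1 : ℂ) • y))
      (Complex.I • P (x + Complex.I • y) (x + Complex.I • y))
    have a2 := norm_sub_le (P (x + y) (x + y)) (P (x + (-1 : ℂ) • y) (x + (-1 : ℂ) • y))
    rw [norm_smul, Complex.norm_I, one_mul] at a1 ⊢
    linarith
  linarith

theorem zero_left (h : HermForm P) (y : Y) : P 0 y = 0 := by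
  have := h.smul_left 0 0 y
  simpa using this

theorem zero_right (h : HermForm P) (y : Y) : P y 0 = 0 := by
  rw [← h.star_eq, h.zero_left, star_zero]

theorem bound (h : HermForm P) (x y : Y) : ‖P x y‖ ≤ 4 * ‖x‖ * ‖y‖ := by
  rcases eq_or_ne x 0 with rfl | hx
  · simp [h.zero_left]
  rcases eq_or_ne y 0 with rfl | hy
  · simp [h.zero_right]
  have hx' : ‖x‖ ≠ 0 := norm_ne_zero_iff.2 hx
  have hy' : ‖y‖ ≠ 0 := norm_ne_zero_iff.2 hy
  have := h.bound_aux (((‖x‖⁻¹ : ℝ) : ℂ) • x) (((‖y‖⁻¹ : ℝ) : ℂ) • y)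
  rw [h.smul_left, h.smul_right, norm_smul, norm_smul, norm_smul, norm_smul] at this
  simp only [Complex.norm_real, Complex.conj_ofReal, norm_inv, norm_norm,
    inv_mul_cancel₀ hx', inv_mul_cancel₀ hy'] at this
  have e : ‖P x y‖ = ‖x‖ * ‖y‖ * (‖x‖⁻¹ * (‖y‖⁻¹ * ‖P x y‖)) := by field_simp
  rw [e]
  calc ‖x‖ * ‖y‖ * (‖x‖⁻¹ * (‖y‖⁻¹ * ‖P x y‖)) ≤ ‖x‖ * ‖y‖ * (1 + 1) ^ 2 := by gcongr
    _ = 4 * ‖x‖ * ‖y‖ := by ring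

/-- The form as a continuous linear map in the first variable. -/
def toCLM (h : HermForm P) (y : Y) : Y →L[ℂ] C :=
  LinearMap.mkContinuous
    { toFun := fun x => P x y
      map_add' := fun a b => h.add_left a b y
      map_smul' := fun t a => h.smul_left t a y } (4 * ‖y‖)
    (fun x => (h.bound x y).trans (le_of_eq (by ring)))

theorem continuous_left (h : HermForm P) (y : Y) : Continuous (fun x => P x y) :=
  (h.toCLM y).continuous

theorem continuous_right (h : HermForm P) (x : Y) : Continuous (fun y => P x y) := by
  have : (fun y => P x y) = fun y => star (P y x) := by
    funext y; rw [h.star_eq]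
  rw [this]
  exact (h.continuous_left x).star

/-- The pullback of the form along finite combinations. -/
theorem comb_eq {I : Type*} (hP : HermForm P) (hQ : HermForm Q) (a : I → Y) (b : I → V)
    (hab : ∀ i j, Q (b i) (b j) = P (a i) (a j)) (p p' : I →₀ ℂ) :
    Q (Finsupp.linearCombination ℂ b p) (Finsupp.linearCombination ℂ b p') =
      P (Finsupp.linearCombination ℂ a p) (Finsupp.linearCombination ℂ a p') := by
  induction p using Finsupp.induction_linear with
  | zero => simp [hP.zero_left, hQ.zero_left]
  | add f g hf hg => rw [map_add, map_add, hP.add_left, hQ.add_left, hf, hg]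
  | single i t =>
    rw [Finsupp.linearCombination_single, Finsupp.linearCombination_single,
      hP.smul_left, hQ.smul_left]
    congr 1
    induction p' using Finsupp.induction_linear with
    | zero => simp [hP.zero_right, hQ.zero_right]
    | add f g hf hg => rw [map_add, map_add, hP.add_right, hQ.add_right, hf, hg]
    | single j t' =>
      rw [Finsupp.linearCombination_single, Finsupp.linearCombination_single,
        hP.smul_right, hQ.smul_right, hab]

theorem denseRange_comb {I : Type*} (a : I → Y)
    (h : Dense (Submodule.span ℂ (Set.range a) : Set Y)) :
    DenseRange (Finsupp.linearCombination ℂ a) := by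
  have : Set.range (Finsupp.linearCombination ℂ a) = (Submodule.span ℂ (Set.range a) : Set Y) := by
    rw [← Finsupp.range_linearCombination]; rfl
  unfold DenseRange
  rw [this]; exact h

theorem exists_isometry {I : Type*} [CompleteSpace Y] [CompleteSpace V]
    (hP : HermForm P) (hQ : HermForm Q) (a : I → Y) (b : I → V)
    (hab : ∀ i j, Q (b i) (b j) = P (a i) (a j))
    (ha : Dense (Submodule.span ℂ (Set.range a) : Set Y))
    (hb : Dense (Submodule.span ℂ (Set.range b) : Set V)) :
    ∃ Φ : Y ≃ₗᵢ[ℂ] V, ∀ i, Φ (a i) = b i := by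
  have hn : ∀ p, ‖Finsupp.linearCombination ℂ b ((LinearEquiv.refl ℂ (I →₀ ℂ)) p)‖ =
      ‖Finsupp.linearCombination ℂ a p‖ := by
    intro p
    have h1 := congrArg norm (comb_eq hP hQ a b hab p p)
    rw [hP.norm_eq, hQ.norm_eq] at h1
    exact (sq_eq_sq₀ (norm_nonneg _) (norm_nonneg _)).1 h1
  refine ⟨LinearEquiv.extendOfIsometry (LinearEquiv.refl ℂ (I →₀ ℂ)) _ _
    (denseRange_comb a ha) (denseRange_comb b hb) hn, fun i => ?_⟩
  have := LinearEquiv.extendOfIsometry_eq (LinearEquiv.refl ℂ (I →₀ ℂ)) _ _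
    (denseRange_comb a ha) (denseRange_comb b hb) hn (Finsupp.single i 1)
  simpa using this

theorem preserve {I : Type*} (hP : HermForm P) (hQ : HermForm Q) (a : I → Y) (b : I → V)
    (hab : ∀ i j, Q (b i) (b j) = P (a i) (a j))
    (ha : Dense (Submodule.span ℂ (Set.range a) : Set Y))
    (Φ : Y ≃ₗᵢ[ℂ] V) (hΦ : ∀ i, Φ (a i) = b i) (x y : Y) : Q (Φ x) (Φ y) = P x y := by
  have hd := denseRange_comb a ha
  have hc : ∀ p, Φ (Finsupp.linearCombination ℂ a p) = Finsupp.linearCombination ℂ b p := by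
    intro p
    have h0 := Finsupp.apply_linearCombination ℂ Φ.toLinearEquiv.toLinearMap a p
    have h1 : (⇑Φ.toLinearEquiv.toLinearMap ∘ a) = b := funext hΦ
    rw [h1] at h0
    exact h0
  have h1 : ∀ p, ∀ y, Q (Φ (Finsupp.linearCombination ℂ a p)) (Φ y) =
      P (Finsupp.linearCombination ℂ a p) y := by
    intro p y
    refine hd.induction_on (p := fun y => Q (Φ (Finsupp.linearCombination ℂ a p)) (Φ y) =
      P (Finsupp.linearCombination ℂ a p) y) y
      (isClosed_eq ((hQ.continuous_right _).comp Φ.continuous) (hP.continuous_right _)) ?_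
    intro p'
    rw [hc, hc, comb_eq hP hQ a b hab]
  exact hd.induction_on (p := fun x => Q (Φ x) (Φ y) = P x y) x
      (isClosed_eq ((hQ.continuous_left _).comp Φ.continuous) (hP.continuous_left _))
      (fun p => h1 p y)

end HermForm

namespace EquivBimodule

variable {C D Y W : Type*}
    [NonUnitalCStarAlgebra C] [PartialOrder C] [StarOrderedRing C]
    [NonUnitalCStarAlgebra D] [PartialOrder D] [StarOrderedRing D]
    [NormedAddCommGroup Y] [NormedSpace ℂ Y] [CompleteSpace Y]
    [NormedAddCommGroup W] [NormedSpace ℂ W] [CompleteSpace W]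

theorem hermL (E : EquivBimodule C D Y) : HermForm E.linn :=
  ⟨E.linn_add_left, E.linn_smul_left, E.linn_star, E.norm_linn⟩

theorem hermR (E : EquivBimodule C D Y) : HermForm (fun x y => E.rinn y x) :=
  ⟨fun x y z => E.rinn_add_right z x y, fun t x y => E.rinn_smul_right t y x,
    fun x y => E.rinn_star y x, E.norm_rinn⟩

theorem linn_lsmul_right (E : EquivBimodule C D Y) (c : C) (x y : Y) :
    E.linn x (E.lsmul c y) = E.linn x y * star c := by
  rw [← E.linn_star, E.linn_lsmul_left, star_mul, E.linn_star]

theorem rinn_rsmul_left (E : EquivBimodule C D Y) (d : D) (x y : Y) :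
    E.rinn (E.rsmul x d) y = star d * E.rinn x y := by
  rw [← E.rinn_star, E.rinn_rsmul_right, star_mul, E.rinn_star]

theorem linn_sub_left (E : EquivBimodule C D Y) (x y z : Y) :
    E.linn (x - y) z = E.linn x z - E.linn y z :=
  map_sub (E.hermL.toCLM z) x y

theorem rinn_sub_right (E : EquivBimodule C D Y) (x y z : Y) :
    E.rinn z (x - y) = E.rinn z x - E.rinn z y :=
  map_sub (E.hermR.toCLM z) x y

theorem ext_linn (E : EquivBimodule C D Y) (x y : Y) (h : ∀ z, E.linn x z = E.linn y z) :
    x = y := by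
  refine sub_eq_zero.1 (E.linn_definite _ ?_)
  rw [E.linn_sub_left, h, sub_self]

theorem ext_rinn (E : EquivBimodule C D Y) (x y : Y) (h : ∀ z, E.rinn z x = E.rinn z y) :
    x = y := by
  refine sub_eq_zero.1 (E.rinn_definite _ ?_)
  rw [E.rinn_sub_right, h, sub_self]

theorem rsmul_sub' (E : EquivBimodule C D Y) (x : Y) (d d' : D) :
    E.rsmul x (d - d') = E.rsmul x d - E.rsmul x d' := by
  rw [eq_sub_iff_add_eq, ← E.rsmul_add, sub_add_cancel]

/-- The left action is adjointable for the right inner product. -/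
theorem rinn_lsmul_left (E : EquivBimodule C D Y) (c : C) (z w : Y) :
    E.rinn (E.lsmul c z) w = E.rinn z (E.lsmul (star c) w) := by
  have h1 : ∀ x, E.rsmul x (E.rinn (E.lsmul c z) w - E.rinn z (E.lsmul (star c) w)) = 0 := by
    intro x
    rw [E.rsmul_sub', ← E.imprimitivity, ← E.imprimitivity, E.linn_lsmul_right, E.mul_lsmul,
      sub_self]
  set δ := E.rinn (E.lsmul c z) w - E.rinn z (E.lsmul (star c) w) with hδ
  have h2 : ∀ d : D, d * δ = 0 := by
    intro d
    refine E.full_right.induction (P := fun d => d * δ = 0) ?_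
      (isClosed_eq (continuous_mul_const δ) continuous_const) d
    intro d hd
    refine Submodule.span_induction ?_ ?_ ?_ ?_ hd
    · rintro _ ⟨x, y, rfl⟩
      rw [← E.rinn_rsmul_right, h1]
      exact E.hermR.zero_left x
    · simp
    · intro a b _ _ ha hb; rw [add_mul, ha, hb, add_zero]
    · intro t a _ ha; rw [smul_mul_assoc, ha, smul_zero]
  exact sub_eq_zero.1 (CStarRing.star_mul_self_eq_zero_iff δ |>.1 (h2 _))

theorem norm_lsmul_le (E : EquivBimodule C D Y) (c : C) (x : Y) :
    ‖E.lsmul c x‖ ≤ ‖c‖ * ‖x‖ := by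
  have : ‖E.lsmul c x‖ ^ 2 ≤ (‖c‖ * ‖x‖) ^ 2 := by
    rw [← E.norm_linn, E.linn_lsmul_left, E.linn_lsmul_right]
    calc _ ≤ ‖c‖ * ‖E.linn x x * star c‖ := norm_mul_le _ _
      _ ≤ ‖c‖ * (‖E.linn x x‖ * ‖star c‖) := by gcongr; exact norm_mul_le _ _
      _ = _ := by rw [E.norm_linn, norm_star]; ring
  exact le_of_sq_le_sq this (by positivity)

theorem norm_rsmul_le (E : EquivBimodule C D Y) (d : D) (x : Y) :
    ‖E.rsmul x d‖ ≤ ‖d‖ * ‖x‖ := by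
  have : ‖E.rsmul x d‖ ^ 2 ≤ (‖d‖ * ‖x‖) ^ 2 := by
    rw [← E.norm_rinn, E.rinn_rsmul_left, E.rinn_rsmul_right]
    calc _ ≤ ‖star d‖ * ‖E.rinn x x * d‖ := norm_mul_le _ _
      _ ≤ ‖star d‖ * (‖E.rinn x x‖ * ‖d‖) := by gcongr; exact norm_mul_le _ _
      _ = _ := by rw [E.norm_rinn, norm_star]; ring
  exact le_of_sq_le_sq this (by positivity)

/-- Equality of Gram matrices on generating families gives an isomorphism. -/
theorem exists_iso {I : Type*} (E : EquivBimodule C D Y) (F : EquivBimodule C D W)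
    (a : I → Y) (b : I → W)
    (hl : ∀ i j, F.linn (b i) (b j) = E.linn (a i) (a j))
    (hr : ∀ i j, F.rinn (b i) (b j) = E.rinn (a i) (a j))
    (ha : Dense (Submodule.span ℂ (Set.range a) : Set Y))
    (hb : Dense (Submodule.span ℂ (Set.range b) : Set W)) :
    ∃ Φ : E.Iso F, ∀ i, Φ.toEquiv (a i) = b i := by
  obtain ⟨Φ, hΦ⟩ := HermForm.exists_isometry E.hermL F.hermL a b hl ha hb
  have pl := HermForm.preserve E.hermL F.hermL a b hl ha Φ hΦ
  have pr : ∀ x y, F.rinn (Φ x) (Φ y) = E.rinn x y := fun x y =>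
    HermForm.preserve E.hermR F.hermR a b (fun i j => hr j i) ha Φ hΦ y x
  refine ⟨⟨Φ.toLinearEquiv, ?_, ?_, pl, pr⟩, hΦ⟩
  · intro c y
    refine F.ext_linn _ _ fun z => ?_
    obtain ⟨z, rfl⟩ := Φ.surjective z
    exact (pl _ _).trans (by rw [E.linn_lsmul_left, F.linn_lsmul_left]; congr 1; exact (pl _ _).symm)
  · intro y d
    refine F.ext_rinn _ _ fun z => ?_
    obtain ⟨z, rfl⟩ := Φ.surjective z
    exact (pr _ _).trans (by rw [E.rinn_rsmul_right, F.rinn_rsmul_right]; congr 1; exact (pr _ _).symm)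

end EquivBimodule

/-- A dense-span extension principle: a linear map which is bounded (in the square sense). -/
theorem mem_of_sq_bound {Y V : Type*} [NormedAddCommGroup Y] [NormedSpace ℂ Y]
    [NormedAddCommGroup V] [NormedSpace ℂ V] (f : Y → V)
    (hadd : ∀ x y, f (x + y) = f x + f y) (hsmul : ∀ (t : ℂ) x, f (t • x) = t • f x)
    (M : ℝ) (hM : ∀ x, ‖f x‖ ^ 2 ≤ M * ‖x‖ ^ 2) (N : Submodule ℂ V)
    (hN : IsClosed (N : Set V)) (s : Set Y) (hs : ∀ x ∈ s, f x ∈ N) (x : Y)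
    (hx : x ∈ closure (Submodule.span ℂ s : Set Y)) : f x ∈ N := by
  let g : Y →L[ℂ] V := LinearMap.mkContinuous
    { toFun := f, map_add' := hadd, map_smul' := hsmul } (1 + |M|) (fun x => by
      refine le_of_sq_le_sq (b := (1 + |M|) * ‖x‖) ((hM x).trans ?_) (by positivity)
      rw [mul_pow]
      gcongr
      nlinarith [abs_nonneg M, le_abs_self M])
  have h1 : Submodule.span ℂ s ≤ N.comap g.toLinearMap := Submodule.span_le.2 hs
  have h2 : IsClosed {x | g x ∈ N} := hN.preimage g.continuous
  exact closure_minimal h1 h2 hx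

namespace EquivBimodule

variable {C D Y : Type*}
    [CStarAlgebra C] [PartialOrder C] [StarOrderedRing C]
    [NonUnitalCStarAlgebra D] [PartialOrder D] [StarOrderedRing D]
    [NormedAddCommGroup Y] [NormedSpace ℂ Y] [CompleteSpace Y]

theorem one_lsmul (E : EquivBimodule C D Y) (y : Y) : E.lsmul 1 y = y :=
  E.ext_linn _ _ fun z => by rw [E.linn_lsmul_left, one_mul]

end EquivBimodule

theorem IsTensorProd.norm_left {C D L Y W V : Type*}
    [NonUnitalCStarAlgebra C] [PartialOrder C] [StarOrderedRing C]
    [NonUnitalCStarAlgebra D] [PartialOrder D] [StarOrderedRing D]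
    [NonUnitalCStarAlgebra L] [PartialOrder L] [StarOrderedRing L]
    [NormedAddCommGroup Y] [NormedSpace ℂ Y] [CompleteSpace Y]
    [NormedAddCommGroup W] [NormedSpace ℂ W] [CompleteSpace W]
    [NormedAddCommGroup V] [NormedSpace ℂ V] [CompleteSpace V]
    {E : EquivBimodule C D Y} {G : EquivBimodule D L W}
    {F : EquivBimodule C L V} {s : Y → W → V} (h : IsTensorProd E G F s) (y : Y) (w : W) :
    ‖s y w‖ ^ 2 ≤ 4 * ‖w‖ ^ 2 * ‖y‖ ^ 2 := by
  rw [← F.norm_linn, h.map_linn]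
  calc _ ≤ 4 * ‖E.rsmul y (G.linn w w)‖ * ‖y‖ := E.hermL.bound _ _
    _ ≤ 4 * (‖G.linn w w‖ * ‖y‖) * ‖y‖ := by gcongr; exact E.norm_rsmul_le _ _
    _ = _ := by rw [G.norm_linn]; ring

theorem IsTensorProd.dense_of_gens {C D L Y W V : Type*}
    [NonUnitalCStarAlgebra C] [PartialOrder C] [StarOrderedRing C]
    [NonUnitalCStarAlgebra D] [PartialOrder D] [StarOrderedRing D]
    [NonUnitalCStarAlgebra L] [PartialOrder L] [StarOrderedRing L]
    [NormedAddCommGroup Y] [NormedSpace ℂ Y] [CompleteSpace Y]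
    [NormedAddCommGroup W] [NormedSpace ℂ W] [CompleteSpace W]
    [NormedAddCommGroup V] [NormedSpace ℂ V] [CompleteSpace V]
    {E : EquivBimodule C D Y} {G : EquivBimodule D L W}
    {F : EquivBimodule C L V} {s : Y → W → V} (h : IsTensorProd E G F s)
    (S : Set Y) (T : Set W) (hS : Dense (Submodule.span ℂ S : Set Y))
    (hT : Dense (Submodule.span ℂ T : Set W)) (N : Submodule ℂ V) (hN : IsClosed (N : Set V))
    (hst : ∀ y ∈ S, ∀ w ∈ T, s y w ∈ N) (v : V) : v ∈ N := by
  have h1 : ∀ y ∈ S, ∀ w, s y w ∈ N := fun y hy w =>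
    mem_of_sq_bound (s y) (h.add_right y) (fun t w => h.smul_right t y w) (4 * ‖y‖ ^ 2)
      (fun w => (h.norm_left y w).trans (le_of_eq (by ring))) N hN T (hst y hy) w (hT w)
  have h2 : ∀ y w, s y w ∈ N := fun y w =>
    mem_of_sq_bound (fun y => s y w) (fun y y' => h.add_left y y' w)
      (fun t y => h.smul_left t y w) (4 * ‖w‖ ^ 2)
      (fun y => h.norm_left y w) N hN S (fun y hy => h1 y hy w) y (hS y)
  have h3 : Submodule.span ℂ {v : V | ∃ y w, v = s y w} ≤ N := by
    refine Submodule.span_le.2 ?_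
    rintro _ ⟨y, w, rfl⟩
    exact h2 y w
  exact closure_minimal h3 hN (h.dense v)

theorem IsUpwardBasic.mem_of_closure {A B C D C₁ D₁ Xc T : Type*}
    [CStarAlgebra A] [CStarAlgebra B] [CStarAlgebra C]
    [CStarAlgebra D] [CStarAlgebra C₁] [CStarAlgebra D₁]
    [PartialOrder A] [StarOrderedRing A] [PartialOrder B] [StarOrderedRing B]
    [PartialOrder C] [StarOrderedRing C] [PartialOrder D] [StarOrderedRing D]
    [PartialOrder C₁] [StarOrderedRing C₁] [PartialOrder D₁] [StarOrderedRing D₁]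
    [NormedAddCommGroup Xc] [NormedSpace ℂ Xc] [CompleteSpace Xc]
    [NormedAddCommGroup T] [NormedSpace ℂ T] [CompleteSpace T]
    {ιA : A →⋆ₐ[ℂ] C} {ιB : B →⋆ₐ[ℂ] D}
    {EA : CondExpectation ιA} {EB : CondExpectation ιB}
    {M : EquivBimodule A B Xc}
    {ιC : C →⋆ₐ[ℂ] C₁} {eA : C₁} {ιD : D →⋆ₐ[ℂ] D₁} {eB : D₁}
    {F : EquivBimodule C₁ D₁ T} {t : C → Xc → D → T}
    (h : IsUpwardBasic ιA ιB EA EB M ιC eA ιD eB F t)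
    (N : Submodule ℂ T) (hN : IsClosed (N : Set T)) (S : Set Xc)
    (hS : Dense (Submodule.span ℂ S : Set Xc))
    (hst : ∀ c, ∀ x ∈ S, ∀ d, t c x d ∈ N) (v : T) : v ∈ N := by
  have h1 : ∀ c x d, t c x d ∈ N := by
    intro c x d
    refine mem_of_sq_bound (fun x => t c x d) (fun x x' => h.add₂ c x x' d)
      (fun z x => h.smul₂ z c x d)
      (‖ιC c‖ * (4 * ‖EB.toFun (star d * d)‖) * ‖eA‖ * ‖ιC (star c)‖) ?_ N hN S
      (fun x hx => hst c x hx d) x (hS x)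
    intro x
    show ‖t c x d‖ ^ 2 ≤ _
    rw [← F.norm_linn, h.linn_eq, map_mul]
    have hA : ∀ a : A, ‖ιC (ιA a)‖ ≤ ‖a‖ := fun a =>
      (NonUnitalStarAlgHom.norm_apply_le ιC _).trans (NonUnitalStarAlgHom.norm_apply_le ιA _)
    have hb : ‖M.linn (M.rsmul x (EB.toFun (star d * d))) x‖ ≤
        4 * (‖EB.toFun (star d * d)‖ * ‖x‖) * ‖x‖ :=
      (M.hermL.bound _ _).trans (by gcongr; exact M.norm_rsmul_le _ _)
    refine (norm_mul_le _ _).trans ?_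
    refine (mul_le_mul_of_nonneg_right (norm_mul_le _ _) (norm_nonneg _)).trans ?_
    refine (mul_le_mul_of_nonneg_right (mul_le_mul_of_nonneg_right (norm_mul_le _ _)
      (norm_nonneg _)) (norm_nonneg _)).trans ?_
    calc _ ≤ ‖ιC c‖ * (4 * (‖EB.toFun (star d * d)‖ * ‖x‖) * ‖x‖) * ‖eA‖ * ‖ιC (star c)‖ := by
          gcongr
          exact (hA _).trans hb
      _ = _ := by ring
  have h3 : Submodule.span ℂ {v : T | ∃ c x d, v = t c x d} ≤ N := by
    refine Submodule.span_le.2 ?_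
    rintro _ ⟨c, x, d, rfl⟩
    exact h1 c x d
  exact closure_minimal h3 hN (h.dense v)

/-- With unital inclusions `A ⊆ C`, `B ⊆ D`, `K ⊆ L` (`A' ∩ C = ℂ1`),
conditional expectations `E^A`, `E^B`, `E^K` of index-finite type, strong Morita
equivalences via `(X,Y)` and `(Z,W)`, C*-basic constructions `C₁`, `D₁`, `L₁`, and
upward basic constructions `Y₁`, `W₁`, `(Y ⊗_D W)₁`, one has
`(Y ⊗_D W)₁ ≅ Y₁ ⊗_{D₁} W₁` as `C₁–L₁`-equivalence bimodules, via
`Φ(c ⊗ x ⊗ d̃ ⊗ d' ⊗ z ⊗ l̃) = c ⊗ x ⊗ E^B(d* d')·z ⊗ l̃`. -/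
theorem upward_of_tensor_iso_tensor_of_upward
    {A B K C D L C₁ D₁ L₁ Y W V T₁ T₂ VG TH : Type*}
    [CStarAlgebra A] [CStarAlgebra B] [CStarAlgebra K]
    [CStarAlgebra C] [CStarAlgebra D] [CStarAlgebra L]
    [CStarAlgebra C₁] [CStarAlgebra D₁] [CStarAlgebra L₁]
    [PartialOrder A] [StarOrderedRing A] [PartialOrder B] [StarOrderedRing B]
    [PartialOrder K] [StarOrderedRing K] [PartialOrder C] [StarOrderedRing C]
    [PartialOrder D] [StarOrderedRing D] [PartialOrder L] [StarOrderedRing L]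
    [PartialOrder C₁] [StarOrderedRing C₁] [PartialOrder D₁] [StarOrderedRing D₁]
    [PartialOrder L₁] [StarOrderedRing L₁]
    [NormedAddCommGroup Y] [NormedSpace ℂ Y] [CompleteSpace Y]
    [NormedAddCommGroup W] [NormedSpace ℂ W] [CompleteSpace W]
    [NormedAddCommGroup V] [NormedSpace ℂ V] [CompleteSpace V]
    [NormedAddCommGroup T₁] [NormedSpace ℂ T₁] [CompleteSpace T₁]
    [NormedAddCommGroup T₂] [NormedSpace ℂ T₂] [CompleteSpace T₂]
    [NormedAddCommGroup VG] [NormedSpace ℂ VG] [CompleteSpace VG]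
    [NormedAddCommGroup TH] [NormedSpace ℂ TH] [CompleteSpace TH]
    (ιA : A →⋆ₐ[ℂ] C) (ιB : B →⋆ₐ[ℂ] D) (ιK : K →⋆ₐ[ℂ] L)
    (hιA : Function.Injective ιA) (hιB : Function.Injective ιB)
    (hιK : Function.Injective ιK)
    (EA : CondExpectation ιA) (EB : CondExpectation ιB) (EK : CondExpectation ιK)
    (hEA : FiniteIndex EA) (hEB : FiniteIndex EB) (hEK : FiniteIndex EK)
    (hirr : IrreducibleIncl ιA)
    -- the C*-basic constructions
    (ιC : C →⋆ₐ[ℂ] C₁) (eA : C₁) (hbcC : IsBasicConstruction ιA EA ιC eA)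
    (ιD : D →⋆ₐ[ℂ] D₁) (eB : D₁) (hbcD : IsBasicConstruction ιB EB ιD eB)
    (ιL : L →⋆ₐ[ℂ] L₁) (eK : L₁) (hbcL : IsBasicConstruction ιK EK ιL eK)
    -- the strong Morita equivalences
    (EY : EquivBimodule C D Y) (X : Submodule ℂ Y) (hmorY : IsMoritaIncl ⇑ιA ⇑ιB EY X)
    (EW : EquivBimodule D L W) (Z : Submodule ℂ W) (hmorW : IsMoritaIncl ⇑ιB ⇑ιK EW Z)
    [CompleteSpace X] (MX : EquivBimodule A B X) (hMX : IsRestriction ⇑ιA ⇑ιB EY X MX)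
    [CompleteSpace Z] (MZ : EquivBimodule B K Z) (hMZ : IsRestriction ⇑ιB ⇑ιK EW Z MZ)
    -- the (unique) conditional expectations `E^X`, `E^Z`
    (EX : Y → Y) (hEX : IsBimodCondExp ιA ιB EA EB EY X EX)
    (EZ : W → W) (hEZ : IsBimodCondExp ιB ιK EB EK EW Z EZ)
    -- the tensor product `Y ⊗_D W` and its subspace `X ⊗_B Z`
    (G : EquivBimodule C L V) (s : Y → W → V) (hG : IsTensorProd EY EW G s)
    (S : Submodule ℂ V)
    (hS : (S : Set V) =
      closure (Submodule.span ℂ {v' : V | ∃ x ∈ X, ∃ z ∈ Z, v' = s x z} : Set V))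
    [CompleteSpace S] (MS : EquivBimodule A K S) (hMS : IsRestriction ⇑ιA ⇑ιK G S MS)
    (hmemS : ∀ (x : X) (b : B) (z : Z), s (x : Y) (EW.lsmul (ιB b) (z : W)) ∈ S)
    (EXZ : V → V) (hEXZ : IsBimodCondExp ιA ιK EA EK G S EXZ)
    -- the upward basic constructions `Y₁`, `W₁` and `(Y ⊗_D W)₁`
    (F₁ : EquivBimodule C₁ D₁ T₁) (t₁ : C → X → D → T₁)
    (hF₁ : IsUpwardBasic ιA ιB EA EB MX ιC eA ιD eB F₁ t₁)
    (F₂ : EquivBimodule D₁ L₁ T₂) (t₂ : D → Z → L → T₂)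
    (hF₂ : IsUpwardBasic ιB ιK EB EK MZ ιD eB ιL eK F₂ t₂)
    (G₁ : EquivBimodule C₁ L₁ VG) (r : C → S → L → VG)
    (hG₁ : IsUpwardBasic ιA ιK EA EK MS ιC eA ιL eK G₁ r)
    -- a realization of the tensor product `Y₁ ⊗_{D₁} W₁`
    (H : EquivBimodule C₁ L₁ TH) (q : T₁ → T₂ → TH) (hH : IsTensorProd F₁ F₂ H q) :
    ∃ Φ : H.Iso G₁, ∀ (c : C) (x : X) (d d' : D) (z : Z) (l : L),
      Φ.toEquiv (q (t₁ c x d) (t₂ d' z l)) =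
        r c ⟨s (x : Y) (EW.lsmul (ιB (EB.toFun (star d * d'))) (z : W)),
          hmemS x (EB.toFun (star d * d')) z⟩ l := by
  let a : C × X × D × D × Z × L → TH := fun i =>
    q (t₁ i.1 i.2.1 i.2.2.1) (t₂ i.2.2.2.1 i.2.2.2.2.1 i.2.2.2.2.2)
  let b : C × X × D × D × Z × L → VG := fun i =>
    r i.1 ⟨s (i.2.1 : Y)
      (EW.lsmul (ιB (EB.toFun (star i.2.2.1 * i.2.2.2.1))) (i.2.2.2.2.1 : W)),
      hmemS i.2.1 (EB.toFun (star i.2.2.1 * i.2.2.2.1)) i.2.2.2.2.1⟩ i.2.2.2.2.2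
  have hl : ∀ i j, G₁.linn (b i) (b j) = H.linn (a i) (a j) := by
    rintro ⟨c, x, d, d', z, l⟩ ⟨c2, x2, d2, d2', z2, l2⟩
    simp only [a, b]
    rw [hH.map_linn, hF₂.linn_eq, F₁.rsmul_mul, F₁.rsmul_mul, hF₁.map_rsmul, hF₁.map_eB,
      hF₁.map_rsmul, hF₁.linn_eq, hG₁.linn_eq]
    congr 5
    apply hιA
    rw [hMS.linn_coe, hMS.rsmul_coe, hMX.linn_coe, hMX.rsmul_coe]
    simp only
    rw [hG.map_rsmul, hG.map_linn]
    congr 2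
    rw [EW.lsmul_rsmul, EW.linn_lsmul_left, EW.linn_lsmul_right, ← hMZ.rsmul_coe,
      ← hMZ.linn_coe, ← map_star, ← map_mul, ← map_mul]
    congr 1
    rw [← EB.map_star]
    simp only [star_mul, star_star, ← map_star, ← EB.map_star]
    rw [mul_assoc (ιB _), EB.left_mod, ← mul_assoc (star d), EB.right_mod]
    rw [mul_assoc]
  have hr : ∀ i j, G₁.rinn (b i) (b j) = H.rinn (a i) (a j) := by
    rintro ⟨c, x, d, d', z, l⟩ ⟨c2, x2, d2, d2', z2, l2⟩
    simp only [a, b]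
    rw [hH.map_rinn, hF₁.rinn_eq, F₂.mul_lsmul, F₂.mul_lsmul, hF₂.map_lsmul, hF₂.map_eA,
      hF₂.map_lsmul, hF₂.rinn_eq, hG₁.rinn_eq]
    congr 4
    apply hιK
    rw [hMS.rinn_coe, hMS.lsmul_coe, hMZ.rinn_coe, hMZ.lsmul_coe]
    simp only
    rw [hG.map_lsmul, hG.map_rinn, EW.rinn_lsmul_left, ← hMX.lsmul_coe, ← hMX.rinn_coe,
      ← EW.mul_lsmul, ← EW.mul_lsmul, ← map_star, ← map_mul, ← map_mul]
    congr 3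
    rw [← EB.map_star, star_mul, star_star, mul_assoc (ιB _), EB.left_mod, ← mul_assoc (star d'),
      EB.right_mod, mul_assoc]
  have hdA : Dense (Submodule.span ℂ (Set.range a) : Set TH) := by
    intro v
    refine hH.dense_of_gens _ _ hF₁.dense hF₂.dense
      (Submodule.span ℂ (Set.range a)).topologicalClosure
      (Submodule.isClosed_topologicalClosure _) ?_ v
    rintro _ ⟨c, x, d, rfl⟩ _ ⟨d', z, l, rfl⟩
    exact Submodule.le_topologicalClosure _ (Submodule.subset_span ⟨(c, x, d, d', z, l), rfl⟩)
  have hdS : Dense (Submodule.span ℂ {σ : S | ∃ (x : X) (z : Z), (σ : V) = s x z} : Set S) := by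
    intro σ
    rw [closure_subtype]
    have h1 : (σ : V) ∈ closure
        (Submodule.span ℂ {v' : V | ∃ x ∈ X, ∃ z ∈ Z, v' = s x z} : Set V) := by
      rw [← hS]; exact σ.2
    refine closure_mono ?_ h1
    have h2 : Submodule.span ℂ {v' : V | ∃ x ∈ X, ∃ z ∈ Z, v' = s x z} ≤
        (Submodule.span ℂ {σ : S | ∃ (x : X) (z : Z), (σ : V) = s x z}).map S.subtype := by
      refine Submodule.span_le.2 ?_
      rintro _ ⟨x, hx, z, hz, rfl⟩
      have hm : s x z ∈ S := by
        have := hmemS ⟨x, hx⟩ 1 ⟨z, hz⟩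
        rwa [map_one, EW.one_lsmul] at this
      exact ⟨⟨s x z, hm⟩, Submodule.subset_span ⟨⟨x, hx⟩, ⟨z, hz⟩, rfl⟩, rfl⟩
    exact h2
  have hdB : Dense (Submodule.span ℂ (Set.range b) : Set VG) := by
    intro v
    refine hG₁.mem_of_closure (Submodule.span ℂ (Set.range b)).topologicalClosure
      (Submodule.isClosed_topologicalClosure _) _ hdS ?_ v
    rintro c ⟨σ, hσ⟩ ⟨x, z, h⟩ l
    refine Submodule.le_topologicalClosure _ (Submodule.subset_span ⟨(c, x, 1, 1, z, l), ?_⟩)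
    simp only [b]
    congr 2
    have h1 : EB.toFun 1 = 1 := by
      have := EB.retraction 1
      rwa [map_one] at this
    simp only at h
    rw [h, star_one, one_mul, h1, map_one, EW.one_lsmul]
  obtain ⟨Φ, hΦ⟩ := EquivBimodule.exists_iso H G₁ a b hl hr hdA hdB
  exact ⟨Φ, fun c x d d' z l => hΦ (c, x, d, d', z, l)⟩

end
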